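/- Let φ: (0,∞) → [0,∞) be C^1 with ∫_0^∞ ρ^{n−1} φ(ρ) dρ < ∞ and |φ'(ρ)| ≤ B/ρ^{n+1} for all ρ > 0. Let ε_j be positive random variables with arbitrary distributions ν_j and set y_j ≡ 0. Then the maximal operator M f(x) = sup_{j≥1} ∫ (∫ (1/s^n) φ(|x−z|/s) dν_j(s)) |f(z)| dz is of weak type (1,1): there is A > 0 with |{x : M f(x) > λ}| ≤ (A/λ) ‖f‖_{L^1} for all f ∈ L^1(R^n) and λ > 0. -/

import Mathlib

open MeasureTheory
open scoped ENNReal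

section EuclideanHarmonicAnalysis

open Metric Set Filter Topology Module

variable {E : Type*} [NormedAddCommGroup E] [NormedSpace ℝ E] [FiniteDimensional ℝ E]
  [MeasurableSpace E] [BorelSpace E] (μ : Measure E) [μ.IsAddHaarMeasure]

theorem lintegral_comp_inv_smul_sub {g : E → ℝ≥0∞} (hg : Measurable g) {r : ℝ} (hr : 0 < r)
    (c : E) :
    ∫⁻ x, g (r⁻¹ • (x - c)) ∂μ = ENNReal.ofReal (r ^ finrank ℝ E) * ∫⁻ x, g x ∂μ := by
  rw [lintegral_sub_right_eq_self (fun x => g (r⁻¹ • x)) c,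
    ← lintegral_map hg (measurable_const_smul _), Measure.map_addHaar_smul μ (inv_ne_zero hr.ne'),
    lintegral_smul_measure, inv_pow, inv_inv, abs_of_pos (by positivity), smul_eq_mul]

theorem addHaar_closedBall_const_mul (c : E) {a r : ℝ} (ha : 0 < a) :
    μ (closedBall c (a * r)) = ENNReal.ofReal (a ^ finrank ℝ E) * μ (closedBall c r) := by
  rw [Measure.addHaar_closedBall_mul_of_pos μ c ha, Measure.addHaar_closedBall_center μ c]

/-- Calderón–Zygmund covering: disjoint balls of large average whose fivefold enlargements have
small average and cover, up to a null set, the points where `h` is large. -/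
theorem exists_countable_disjoint_stopping_closedBalls [Nontrivial E] {h : E → ℝ≥0∞}
    (hh : AEMeasurable h μ)
    (hfin : ∫⁻ z, h z ∂μ ≠ ∞) {t : ℝ≥0∞} (ht0 : t ≠ 0) (ht : t ≠ ∞) :
    ∃ u : Set (E × ℝ), u.Countable ∧ (∀ p ∈ u, 0 < p.2) ∧
      (u.PairwiseDisjoint fun p => closedBall p.1 p.2) ∧
      (∀ p ∈ u, t * μ (closedBall p.1 p.2) ≤ ∫⁻ z in closedBall p.1 p.2, h z ∂μ) ∧
      (∀ p ∈ u, ∫⁻ z in closedBall p.1 (5 * p.2), h z ∂μ ≤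
        t * μ (closedBall p.1 (5 * p.2))) ∧
      ∀ᵐ x ∂μ, x ∉ ⋃ p ∈ u, closedBall p.1 (5 * p.2) → h x ≤ t := by
  have hd : finrank ℝ E ≠ 0 := finrank_pos.ne'
  obtain ⟨R, hR⟩ : ∃ R : ℝ, ∀ c r, t * μ (closedBall c r) < ∫⁻ z in closedBall c r, h z ∂μ →
      r ≤ R := by
    have hlim : Tendsto (fun r : ℝ => t * (ENNReal.ofReal (r ^ finrank ℝ E) *
        μ (closedBall (0 : E) 1))) atTop (𝓝 ∞) := by
      have h1 : Tendsto (fun r : ℝ => ENNReal.ofReal (r ^ finrank ℝ E)) atTop (𝓝 ∞) :=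
        ENNReal.tendsto_ofReal_atTop.comp (tendsto_pow_atTop hd)
      have hb : μ (closedBall (0 : E) 1) ≠ 0 := (measure_closedBall_pos μ _ one_pos).ne'
      have h2 := ENNReal.Tendsto.const_mul (a := t) (ENNReal.Tendsto.mul_const
        (b := μ (closedBall (0 : E) 1)) h1 (Or.inl ENNReal.top_ne_zero)) (Or.inr ht)
      simpa [ENNReal.top_mul hb, ENNReal.mul_top ht0] using h2
    obtain ⟨R, hR⟩ := ((hlim.eventually (lt_mem_nhds hfin.lt_top)).and
      (eventually_ge_atTop 0)).exists_forall_of_atTop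
    refine ⟨R, fun c r hcr => le_of_not_gt fun hlt => ?_⟩
    obtain ⟨h1, h0⟩ := hR r hlt.le
    rw [← Measure.addHaar_closedBall' μ c h0] at h1
    exact (h1.trans hcr).not_ge (setLIntegral_le_lintegral _ _)
  set T : Set (E × ℝ) := {p | 0 < p.2 ∧
    t * μ (closedBall p.1 p.2) < ∫⁻ z in closedBall p.1 p.2, h z ∂μ ∧
    ∫⁻ z in closedBall p.1 (5 * p.2), h z ∂μ ≤ t * μ (closedBall p.1 (5 * p.2))}
  have hex : ∀ c r, 0 < r → t * μ (closedBall c r) < ∫⁻ z in closedBall c r, h z ∂μ →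
      ∃ s, (c, s) ∈ T := by
    intro c r hr hcr
    by_contra! hcon
    have hpow : ∀ k : ℕ, t * μ (closedBall c (5 ^ k * r)) <
        ∫⁻ z in closedBall c (5 ^ k * r), h z ∂μ := by
      intro k
      induction k with
      | zero => simpa using hcr
      | succ k ih =>
        by_contra! hle
        refine hcon (5 ^ k * r) ⟨by positivity, ih, ?_⟩
        rwa [pow_succ', mul_assoc] at hle
    have htop : Tendsto (fun k : ℕ => (5 : ℝ) ^ k * r) atTop atTop :=
      (tendsto_pow_atTop_atTop_of_one_lt (by norm_num)).atTop_mul_const hr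
    obtain ⟨k, hk⟩ := (htop.eventually_gt_atTop R).exists
    exact hk.not_ge (hR c _ (hpow k))
  obtain ⟨u, huT, hdisj, hcov⟩ := Vitali.exists_disjoint_subfamily_covering_enlargement_closedBall T
    Prod.fst Prod.snd R (fun p hp => hR _ _ hp.2.1) 5 (by norm_num)
  refine ⟨u, ?_, fun p hp => (huT hp).1, hdisj, fun p hp => (huT hp).2.1.le,
    fun p hp => (huT hp).2.2, ?_⟩
  · refine hdisj.countable_of_nonempty_interior fun p hp => ⟨p.1, ?_⟩
    exact ball_subset_interior_closedBall (mem_ball_self (huT hp).1)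
  · filter_upwards [(Besicovitch.vitaliFamily μ).ae_tendsto_lintegral_div hh hfin] with x hx hxu
    refine le_of_tendsto (hx.comp (Besicovitch.tendsto_filterAt μ x)) ?_
    filter_upwards [self_mem_nhdsWithin] with r hr
    refine ENNReal.div_le_of_le_mul (le_of_not_gt fun hlt => hxu ?_)
    obtain ⟨s, hs⟩ := hex x r hr hlt
    obtain ⟨p, hp, hsub⟩ := hcov _ hs
    exact mem_biUnion hp (hsub (mem_closedBall_self hs.1.le))

/-- Zó's theorem: a family of nonnegative convolution kernels which is bounded in `L¹` and
uniformly smooth defines a maximal operator of weak type (1,1). -/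
theorem measure_lt_iSup_lconvolution_le [Nontrivial E] {ι : Type*} {k : ι → E → ℝ≥0∞}
    (hk : ∀ j, Measurable (k j)) {κ J : ℝ≥0∞} (hκ : 1 ≤ κ) (hκ' : κ ≠ ∞)
    (hkint : ∀ j, ∫⁻ z, k j z ∂μ ≤ κ)
    {D : ℝ → E → ℝ≥0∞} (hD : ∀ r, Measurable (D r))
    (hDint : ∀ r, 0 < r → ∫⁻ x, D r x ∂μ ≤ J)
    (hsmooth : ∀ r, 0 < r → ∀ j x z w, ‖z‖ ≤ 5 * r → ‖w‖ ≤ 5 * r → 10 * r < ‖x‖ →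
      k j (x - z) ≤ k j (x - w) + D r x)
    {h : E → ℝ≥0∞} (hh : AEMeasurable h μ)
    (hfin : ∫⁻ z, h z ∂μ ≠ ∞) {t : ℝ≥0∞} (ht0 : t ≠ 0) (ht : t ≠ ∞) :
    μ {x | 2 * ((1 + ENNReal.ofReal (5 ^ finrank ℝ E)) * κ * t) <
        ⨆ j, ∫⁻ z, k j (x - z) * h z ∂μ} ≤
      (ENNReal.ofReal (10 ^ finrank ℝ E) + J) * ((∫⁻ z, h z ∂μ) / t) := by
  obtain ⟨u, hu, hpos, hdisj, hlarge, hsmall, hgood⟩ :=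
    exists_countable_disjoint_stopping_closedBalls μ hh hfin ht0 ht
  have := hu.to_subtype
  set N := ENNReal.ofReal (5 ^ finrank ℝ E)
  have hNtop : N ≠ ∞ := ENNReal.ofReal_ne_top
  have hdisj' : Pairwise (Function.onFun Disjoint fun p : u => closedBall p.1.1 p.1.2) :=
    (pairwise_subtype_iff_pairwise_set u _).2 hdisj
  have hvol : ∑' p : u, μ (closedBall p.1.1 p.1.2) ≤ (∫⁻ z, h z ∂μ) / t := by
    rw [ENNReal.le_div_iff_mul_le (Or.inl ht0) (Or.inl ht), mul_comm, ← ENNReal.tsum_mul_left]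
    calc _ ≤ ∑' p : u, ∫⁻ z in closedBall p.1.1 p.1.2, h z ∂μ :=
          ENNReal.tsum_le_tsum fun p => hlarge _ p.2
      _ = ∫⁻ z in ⋃ p : u, closedBall p.1.1 p.1.2, h z ∂μ :=
          (lintegral_iUnion (fun _ => measurableSet_closedBall) hdisj' _).symm
      _ ≤ _ := setLIntegral_le_lintegral _ _
  have htrans : ∀ j x, ∫⁻ z, k j (x - z) ∂μ ≤ κ := fun j x =>
    (lintegral_sub_left_eq_self (k j) x).trans_le (hkint j)
  set G : E → ℝ≥0∞ := fun x =>
    N * t * ∑' p : u, μ (closedBall p.1.1 p.1.2) * D p.1.2 (x - p.1.1)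
  have hGmeas : Measurable G := by
    refine Measurable.const_mul (Measurable.tsum fun p => Measurable.const_mul ?_ _) _
    exact (hD _).comp (measurable_id.sub_const _)
  have hGint : ∫⁻ x, G x ∂μ ≤ N * t * (J * ((∫⁻ z, h z ∂μ) / t)) := by
    have hm : ∀ p : u, Measurable fun x => D p.1.2 (x - p.1.1) := fun p =>
      (hD _).comp (measurable_id.sub_const _)
    rw [lintegral_const_mul _ (Measurable.tsum fun p => (hm p).const_mul _),
      lintegral_tsum fun p => ((hm p).const_mul _).aemeasurable]
    gcongr
    calc _ ≤ ∑' p : u, J * μ (closedBall p.1.1 p.1.2) := by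
          refine ENNReal.tsum_le_tsum fun p => ?_
          rw [lintegral_const_mul _ (hm p), lintegral_sub_right_eq_self (D p.1.2), mul_comm]
          gcongr
          exact hDint _ (hpos _ p.2)
      _ ≤ _ := by rw [ENNReal.tsum_mul_left]; gcongr
  have hpoint : ∀ x, x ∉ ⋃ p : u, closedBall p.1.1 (10 * p.1.2) → ∀ j,
      ∫⁻ z, k j (x - z) * h z ∂μ ≤ (1 + N) * κ * t + G x := by
    intro x hx j
    have hkx : Measurable fun z => k j (x - z) := (hk j).comp (measurable_id.const_sub x)
    have hU : MeasurableSet (⋃ p : u, closedBall p.1.1 (5 * p.1.2)) :=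
      MeasurableSet.iUnion fun _ => measurableSet_closedBall
    have hout : ∫⁻ z in (⋃ p : u, closedBall p.1.1 (5 * p.1.2))ᶜ, k j (x - z) * h z ∂μ ≤
        κ * t := by
      calc _ ≤ ∫⁻ z in (⋃ p : u, closedBall p.1.1 (5 * p.1.2))ᶜ, k j (x - z) * t ∂μ := by
            refine setLIntegral_mono_ae' hU.compl ?_
            filter_upwards [hgood] with z hz hzU
            gcongr
            refine hz ?_
            rwa [biUnion_eq_iUnion]
        _ ≤ ∫⁻ z, k j (x - z) * t ∂μ := setLIntegral_le_lintegral _ _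
        _ ≤ κ * t := by
            rw [lintegral_mul_const _ hkx]
            gcongr
            exact htrans j x
    have hball : ∀ p : u, ∫⁻ z in closedBall p.1.1 (5 * p.1.2), k j (x - z) * h z ∂μ ≤
        N * t * (∫⁻ w in closedBall p.1.1 p.1.2, k j (x - w) ∂μ +
          μ (closedBall p.1.1 p.1.2) * D p.1.2 (x - p.1.1)) := by
      rintro ⟨⟨c, r⟩, hp⟩
      have hr : 0 < r := hpos _ hp
      have hV0 : μ (closedBall c r) ≠ 0 := (measure_closedBall_pos μ c hr).ne'
      have hVtop : μ (closedBall c r) ≠ ∞ := measure_closedBall_lt_top.ne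
      have hxc : 10 * r < ‖x - c‖ := by
        have : x ∉ closedBall c (10 * r) := fun hxc => hx (mem_iUnion.2 ⟨⟨_, hp⟩, hxc⟩)
        simpa [dist_eq_norm] using this
      set S := ∫⁻ w in closedBall c r, k j (x - w) ∂μ + μ (closedBall c r) * D r (x - c)
      have hS : ∀ z ∈ closedBall c (5 * r), k j (x - z) ≤ S / μ (closedBall c r) := by
        intro z hz
        rw [ENNReal.le_div_iff_mul_le (Or.inl hV0) (Or.inl hVtop)]
        calc _ = ∫⁻ _ in closedBall c r, k j (x - z) ∂μ := by simp
          _ ≤ ∫⁻ w in closedBall c r, (k j (x - w) + D r (x - c)) ∂μ := by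
              refine setLIntegral_mono' measurableSet_closedBall fun w hw => ?_
              have hw' : ‖w - c‖ ≤ r := by simpa [dist_eq_norm] using hw
              have := hsmooth r hr j (x - c) (z - c) (w - c)
                (by simpa [dist_eq_norm] using hz) (by linarith) hxc
              simpa using this
          _ = S := by
              rw [lintegral_add_right _ measurable_const, setLIntegral_const,
                mul_comm (D r (x - c))]
      calc _ ≤ ∫⁻ z in closedBall c (5 * r), S / μ (closedBall c r) * h z ∂μ := by
            refine setLIntegral_mono' measurableSet_closedBall fun z hz => ?_
            gcongr
            exact hS z hz
        _ = S / μ (closedBall c r) * ∫⁻ z in closedBall c (5 * r), h z ∂μ :=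
            lintegral_const_mul'' _ hh.restrict
        _ ≤ S / μ (closedBall c r) * (t * (N * μ (closedBall c r))) := by
            gcongr
            rw [← addHaar_closedBall_const_mul μ c (by norm_num : (0 : ℝ) < 5)]
            exact hsmall _ hp
        _ = N * t * (S / μ (closedBall c r) * μ (closedBall c r)) := by ring
        _ = N * t * S := by rw [ENNReal.div_mul_cancel hV0 hVtop]
    have hin : ∫⁻ z in ⋃ p : u, closedBall p.1.1 (5 * p.1.2), k j (x - z) * h z ∂μ ≤
        N * t * κ + G x := by
      calc _ ≤ ∑' p : u, ∫⁻ z in closedBall p.1.1 (5 * p.1.2), k j (x - z) * h z ∂μ :=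
            lintegral_iUnion_le _ _
        _ ≤ _ := ENNReal.tsum_le_tsum hball
        _ = N * t * (∑' p : u, ∫⁻ w in closedBall p.1.1 p.1.2, k j (x - w) ∂μ) + G x := by
            rw [ENNReal.tsum_mul_left, ENNReal.tsum_add, mul_add]
        _ ≤ _ := by
            gcongr
            rw [← lintegral_iUnion (fun _ => measurableSet_closedBall) hdisj']
            exact (setLIntegral_le_lintegral _ _).trans (htrans j x)
    rw [← lintegral_add_compl _ hU]
    calc _ ≤ (N * t * κ + G x) + κ * t := add_le_add hin hout
      _ = _ := by ring
  set a := (1 + N) * κ * t with ha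
  have hatop : a ≠ ∞ := by finiteness
  have ha0 : a ≠ 0 := by
    have : κ ≠ 0 := (zero_lt_one.trans_le hκ).ne'
    simp [ha, ht0, this]
  have hNa : N * t ≤ a := by
    calc N * t = N * 1 * t := by ring
      _ ≤ a := by rw [ha]; gcongr; exact le_add_self
  calc _ ≤ μ ((⋃ p : u, closedBall p.1.1 (10 * p.1.2)) ∪ {x | a ≤ G x}) := by
        refine measure_mono fun x hx => or_iff_not_imp_left.2 fun hxU => ?_
        have h1 : a + a < a + G x := by
          rw [← two_mul]
          exact lt_of_lt_of_le hx (iSup_le (hpoint x hxU))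
        exact (ENNReal.add_lt_add_iff_left hatop).1 h1 |>.le
    _ ≤ μ (⋃ p : u, closedBall p.1.1 (10 * p.1.2)) + μ {x | a ≤ G x} := measure_union_le _ _
    _ ≤ ENNReal.ofReal (10 ^ finrank ℝ E) * ((∫⁻ z, h z ∂μ) / t) +
        J * ((∫⁻ z, h z ∂μ) / t) := by
        gcongr
        · refine (measure_iUnion_le _).trans ?_
          simp_rw [addHaar_closedBall_const_mul μ _ (by norm_num : (0 : ℝ) < 10)]
          rw [ENNReal.tsum_mul_left]
          gcongr
        · refine (meas_ge_le_lintegral_div hGmeas.aemeasurable ha0 hatop).trans ?_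
          refine ENNReal.div_le_of_le_mul (hGint.trans ?_)
          rw [mul_comm]
          gcongr
    _ = _ := by ring

theorem lintegral_ofReal_fun_norm_lt_top [Nontrivial E] {φ : ℝ → ℝ} (hφ : ∀ ρ, 0 < ρ → 0 ≤ φ ρ)
    (hφmeas : Measurable φ)
    (hφint : ∫⁻ ρ in Ioi (0 : ℝ), ENNReal.ofReal (ρ ^ (finrank ℝ E - 1) * φ ρ) < ∞) :
    ∫⁻ x, ENNReal.ofReal (φ ‖x‖) ∂μ < ∞ := by
  refine Integrable.lintegral_lt_top ((integrable_fun_norm_addHaar μ).2 ⟨?_, ?_⟩)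
  · exact ((measurable_id.pow_const _).smul hφmeas).aestronglyMeasurable
  · rw [hasFiniteIntegral_iff_ofReal]
    · simpa only [smul_eq_mul] using hφint
    · filter_upwards [ae_restrict_mem measurableSet_Ioi] with ρ hρ
      exact mul_nonneg (pow_nonneg (le_of_lt hρ) _) (hφ ρ hρ)

theorem lintegral_dilation_eq {φ : ℝ → ℝ} (hφmeas : Measurable φ) {s : ℝ} (hs : 0 < s) :
    ∫⁻ x : E, ENNReal.ofReal (1 / s ^ finrank ℝ E * φ (‖x‖ / s)) ∂μ =
      ∫⁻ x, ENNReal.ofReal (φ ‖x‖) ∂μ := by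
  have hg : Measurable fun x : E => ENNReal.ofReal (φ ‖x‖) := by fun_prop
  have hpow : 0 < s ^ finrank ℝ E := by positivity
  calc _ = ∫⁻ x : E, ENNReal.ofReal (1 / s ^ finrank ℝ E) *
        ENNReal.ofReal (φ ‖s⁻¹ • (x - 0)‖) ∂μ := by
        refine lintegral_congr fun x => ?_
        rw [ENNReal.ofReal_mul (by positivity), sub_zero, norm_smul, norm_inv, Real.norm_eq_abs,
          abs_of_pos hs, inv_mul_eq_div]
    _ = _ := by
        rw [lintegral_const_mul _ (by fun_prop), lintegral_comp_inv_smul_sub μ hg hs, ← mul_assoc,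
          ← ENNReal.ofReal_mul (by positivity), one_div_mul_cancel hpow.ne', ENNReal.ofReal_one,
          one_mul]

theorem dilation_le_add {φ φ' : ℝ → ℝ} {n : ℕ} {B : ℝ}
    (hφderiv : ∀ ρ : ℝ, 0 < ρ → HasDerivAt φ (φ' ρ) ρ)
    (hφ'bound : ∀ ρ : ℝ, 0 < ρ → |φ' ρ| ≤ B / ρ ^ (n + 1)) (hB : 0 ≤ B)
    {s m a b : ℝ} (hs : 0 < s) (hm : 0 < m) (ha : m ≤ a) (hb : m ≤ b) :
    1 / s ^ n * φ (a / s) ≤ 1 / s ^ n * φ (b / s) + B / m ^ (n + 1) * |a - b| := by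
  have hms : 0 < m / s := div_pos hm hs
  have key := Convex.norm_image_sub_le_of_norm_hasDerivWithin_le (f := φ) (f' := φ')
    (C := B / (m / s) ^ (n + 1)) (s := Ici (m / s)) (x := b / s) (y := a / s)
    (fun x hx => (hφderiv x (hms.trans_le hx)).hasDerivWithinAt)
    (fun x hx => (hφ'bound x (hms.trans_le hx)).trans (by
      have : m / s ≤ x := hx
      gcongr)) (convex_Ici _)
    (show m / s ≤ b / s by gcongr) (show m / s ≤ a / s by gcongr)
  rw [Real.norm_eq_abs, Real.norm_eq_abs, ← sub_div, abs_div, abs_of_pos hs] at key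
  have h1 : φ (a / s) ≤ φ (b / s) + B / (m / s) ^ (n + 1) * (|a - b| / s) := by
    linarith [le_abs_self (φ (a / s) - φ (b / s))]
  calc _ ≤ 1 / s ^ n * (φ (b / s) + B / (m / s) ^ (n + 1) * (|a - b| / s)) := by gcongr
    _ = _ := by rw [div_pow]; field_simp; ring

theorem lintegral_smoothness_majorant {B r : ℝ} (hB : 0 ≤ B) (hr : 0 < r) :
    ∫⁻ x : E, ENNReal.ofReal (B / ((r + ‖x‖) / 4) ^ (finrank ℝ E + 1) * (10 * r)) ∂μ =
      ENNReal.ofReal (10 * B * 4 ^ (finrank ℝ E + 1)) *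
        ∫⁻ x : E, ENNReal.ofReal ((1 + ‖x‖) ^ (-((finrank ℝ E + 1 : ℕ) : ℝ))) ∂μ := by
  set d := finrank ℝ E with hd
  have hpow : 0 < r ^ d := by positivity
  have hg : Measurable fun x : E => ENNReal.ofReal ((1 + ‖x‖) ^ (-((d + 1 : ℕ) : ℝ))) := by
    fun_prop
  calc _ = ∫⁻ x : E, ENNReal.ofReal (10 * B * 4 ^ (d + 1) * (1 / r ^ d)) *
        ENNReal.ofReal ((1 + ‖r⁻¹ • (x - 0)‖) ^ (-((d + 1 : ℕ) : ℝ))) ∂μ := by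
        refine lintegral_congr fun x => ?_
        rw [← ENNReal.ofReal_mul (by positivity), sub_zero, norm_smul, norm_inv, Real.norm_eq_abs,
          abs_of_pos hr, inv_mul_eq_div, Real.rpow_neg (by positivity), Real.rpow_natCast]
        congr 1
        have h1 : 1 + ‖x‖ / r = (r + ‖x‖) / r := by field_simp
        have h2 : 0 < r + ‖x‖ := by positivity
        rw [h1, div_pow, div_pow]
        field_simp
        ring
    _ = _ := by
        rw [lintegral_const_mul _ (by fun_prop), lintegral_comp_inv_smul_sub μ hg hr, ← mul_assoc,
          ← ENNReal.ofReal_mul (by positivity), mul_assoc, one_div_mul_cancel hpow.ne', mul_one]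

end EuclideanHarmonicAnalysis

/-- Random variance only: if `φ` is `C¹` on `(0,∞)` with finite radial integral and
`|φ'(ρ)| ≤ B/ρ^{n+1}`, then for arbitrary probability distributions `ν_j` on `(0,∞)` the
maximal operator `M f x = ⨆ j, ∫ (∫ s^{-n} φ(‖x-z‖/s) dν_j(s)) |f z| dz` is of weak
type (1,1). -/
theorem maximal_weak_type_random_variance
    (n : ℕ) (hn : 1 ≤ n) (φ φ' : ℝ → ℝ) (hφnonneg : ∀ ρ, 0 < ρ → 0 ≤ φ ρ)
    (hφmeas : Measurable φ)
    (hφint : ∫⁻ ρ in Set.Ioi (0:ℝ), ENNReal.ofReal (ρ ^ (n - 1) * φ ρ) < ⊤)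
    (hφderiv : ∀ ρ : ℝ, 0 < ρ → HasDerivAt φ (φ' ρ) ρ)
    (B : ℝ) (hB : 0 < B)
    (hφ'bound : ∀ ρ : ℝ, 0 < ρ → |φ' ρ| ≤ B / ρ ^ (n + 1))
    (ν : ℕ → Measure ℝ) (hprob : ∀ j, IsProbabilityMeasure (ν j))
    (hν : ∀ j, ν j (Set.Iic 0) = 0) :
    ∃ A : ℝ, 0 < A ∧
      ∀ f : EuclideanSpace ℝ (Fin n) → ℝ, Integrable f → ∀ lam : ℝ, 0 < lam →
        volume {x : EuclideanSpace ℝ (Fin n) |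
            ENNReal.ofReal lam <
              ⨆ j, ∫⁻ z,
                (∫⁻ s, ENNReal.ofReal ((1 / s ^ n) * φ (‖x - z‖ / s)) ∂(ν j)) *
                  ENNReal.ofReal |f z| ∂volume} ≤
          ENNReal.ofReal (A / lam) * ∫⁻ z, ENNReal.ofReal |f z| ∂volume := by
  have hdim : Module.finrank ℝ (EuclideanSpace ℝ (Fin n)) = n := finrank_euclideanSpace_fin
  have : Nontrivial (EuclideanSpace ℝ (Fin n)) :=
    Module.nontrivial_of_finrank_pos (R := ℝ) (by omega)
  set k : ℕ → EuclideanSpace ℝ (Fin n) → ℝ≥0∞ := fun j x =>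
    ∫⁻ s, ENNReal.ofReal ((1 / s ^ n) * φ (‖x‖ / s)) ∂(ν j) with hkdef
  set κ : ℝ≥0∞ := 1 + ∫⁻ x : EuclideanSpace ℝ (Fin n), ENNReal.ofReal (φ ‖x‖) with hκdef
  have hκ' : κ ≠ ∞ := by
    have := lintegral_ofReal_fun_norm_lt_top (E := EuclideanSpace ℝ (Fin n)) volume hφnonneg hφmeas
      (by rwa [hdim])
    finiteness
  have hpos : ∀ j, ∀ᵐ s ∂(ν j), 0 < s := fun j => by
    rw [ae_iff]
    simpa [Set.Iic] using hν j
  have hF : Measurable fun p : EuclideanSpace ℝ (Fin n) × ℝ =>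
      ENNReal.ofReal ((1 / p.2 ^ n) * φ (‖p.1‖ / p.2)) := by fun_prop
  have hk : ∀ j, Measurable (k j) := fun j => hF.lintegral_prod_right'
  have hkint : ∀ j, ∫⁻ x, k j x ≤ κ := by
    intro j
    calc ∫⁻ x, k j x = ∫⁻ s, (∫⁻ x : EuclideanSpace ℝ (Fin n),
          ENNReal.ofReal ((1 / s ^ n) * φ (‖x‖ / s))) ∂(ν j) :=
          lintegral_lintegral_swap hF.aemeasurable
      _ = ∫⁻ _, (∫⁻ x : EuclideanSpace ℝ (Fin n), ENNReal.ofReal (φ ‖x‖)) ∂(ν j) := by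
          refine lintegral_congr_ae ?_
          filter_upwards [hpos j] with s hs
          have := lintegral_dilation_eq (E := EuclideanSpace ℝ (Fin n)) volume hφmeas hs
          rwa [hdim] at this
      _ ≤ κ := by simp [hκdef]
  set D : ℝ → EuclideanSpace ℝ (Fin n) → ℝ≥0∞ := fun r x =>
    ENNReal.ofReal (B / ((r + ‖x‖) / 4) ^ (n + 1) * (10 * r))
  set J : ℝ≥0∞ := ENNReal.ofReal (10 * B * 4 ^ (n + 1)) *
    ∫⁻ x : EuclideanSpace ℝ (Fin n), ENNReal.ofReal ((1 + ‖x‖) ^ (-((n + 1 : ℕ) : ℝ)))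
  have hJ : J ≠ ∞ := by
    have : ∫⁻ x : EuclideanSpace ℝ (Fin n),
        ENNReal.ofReal ((1 + ‖x‖) ^ (-((n + 1 : ℕ) : ℝ))) < ∞ :=
      finite_integral_one_add_norm (by rw [hdim]; push_cast; linarith)
    finiteness
  have hDint : ∀ r, 0 < r → ∫⁻ x, D r x ≤ J := fun r hr => by
    have := lintegral_smoothness_majorant (E := EuclideanSpace ℝ (Fin n)) volume hB.le hr
    rw [hdim] at this
    exact this.le
  have hsmooth : ∀ r, 0 < r → ∀ j x z w, ‖z‖ ≤ 5 * r → ‖w‖ ≤ 5 * r → 10 * r < ‖x‖ →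
      k j (x - z) ≤ k j (x - w) + D r x := by
    intro r hr j x z w hz hw hx
    have hxz := norm_sub_norm_le x z
    have hxw := norm_sub_norm_le x w
    have hzw : |‖x - z‖ - ‖x - w‖| ≤ 10 * r := by
      have h1 := abs_norm_sub_norm_le (x - z) (x - w)
      have h2 := norm_sub_le w z
      rw [sub_sub_sub_cancel_left] at h1
      linarith
    calc k j (x - z) ≤ ∫⁻ s, (ENNReal.ofReal ((1 / s ^ n) * φ (‖x - w‖ / s)) + D r x) ∂(ν j) := by
          refine lintegral_mono_ae ?_
          filter_upwards [hpos j] with s hs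
          refine (ENNReal.ofReal_le_ofReal ?_).trans ENNReal.ofReal_add_le
          refine (dilation_le_add hφderiv hφ'bound hB.le (m := (r + ‖x‖) / 4) (b := ‖x - w‖) hs
            (by positivity) (by linarith) (by linarith)).trans ?_
          gcongr
      _ = k j (x - w) + D r x := by
          rw [lintegral_add_right _ measurable_const]
          simp [hkdef]
  set N : ℝ≥0∞ := ENNReal.ofReal (5 ^ n)
  set M : ℝ≥0∞ := 2 * ((1 + N) * κ) with hM
  have hκ0 : κ ≠ 0 := by simp [hκdef]
  have hM0 : M ≠ 0 := by simp [hM, hκ0]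
  have hMtop : M ≠ ∞ := by finiteness
  set C : ℝ≥0∞ := (ENNReal.ofReal (10 ^ n) + J) * M with hC
  have hCtop : C ≠ ∞ := by finiteness
  have hC0 : C ≠ 0 := by simp [hC, hM0]
  refine ⟨C.toReal, ENNReal.toReal_pos hC0 hCtop, fun f hf lam hlam => ?_⟩
  have hfin : ∫⁻ z, ENNReal.ofReal |f z| ≠ ∞ := hf.abs.lintegral_lt_top.ne
  have hl0 : ENNReal.ofReal lam ≠ 0 := by simpa using hlam
  have main := measure_lt_iSup_lconvolution_le (E := EuclideanSpace ℝ (Fin n)) volume hk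
    (t := ENNReal.ofReal lam / M) le_self_add hκ' hkint (fun r => by fun_prop) hDint hsmooth
    hf.abs.aemeasurable.ennreal_ofReal hfin (ENNReal.div_ne_zero.2 ⟨hl0, hMtop⟩)
    (ENNReal.div_ne_top ENNReal.ofReal_ne_top hM0)
  rw [hdim, ← mul_assoc 2, ← hM, ENNReal.mul_div_cancel hM0 hMtop] at main
  refine main.trans_eq ?_
  rw [ENNReal.ofReal_div_of_pos hlam, ENNReal.ofReal_toReal hCtop, hC, div_eq_mul_inv,
    ENNReal.inv_div (Or.inl hMtop) (Or.inl hM0)]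
  simp only [div_eq_mul_inv]
  ring
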